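/- Let z be a global minimizer of the continuous relaxation problem such that for every block index i the argmax set J_i(z) = argmax_r z^{(i)}_r is a singleton {s_i}. Then the point x* defined by x*^{(i)} = e_{s_i} (the standard unit vector in ℝ^{l_i}) for every i is a global minimizer of the CPD integer problem, and its support satisfies Γ(x*) = {(i, s_i) : i = 1,…,n}. -/

import Mathlib

open Finset Filter

noncomputable section

/-- The QSAP objective `f(x) = (1/2) xᵀBx + aᵀx` written blockwise. -/
def qsapF {n : ℕ} {l : Fin n → ℕ}
    (a : (i : Fin n) → Fin (l i) → ℝ)
    (B : (i : Fin n) → (j : Fin n) → Matrix (Fin (l i)) (Fin (l j)) ℝ)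
    (x : (i : Fin n) → Fin (l i) → ℝ) : ℝ :=
  (1 / 2) * (∑ i, ∑ j, ∑ r, ∑ s, B i j r s * x i r * x j s)
    + ∑ i, ∑ r, a i r * x i r

/-- Feasibility for the continuous relaxation: each block sums to one, entries nonnegative. -/
def RelaxFeas {n : ℕ} {l : Fin n → ℕ} (x : (i : Fin n) → Fin (l i) → ℝ) : Prop :=
  (∀ i, ∑ r, x i r = 1) ∧ ∀ i r, 0 ≤ x i r

/-- Feasibility for the CPD integer problem: each block sums to one, entries in {0,1}. -/
def IntFeas {n : ℕ} {l : Fin n → ℕ} (x : (i : Fin n) → Fin (l i) → ℝ) : Prop :=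
  (∀ i, ∑ r, x i r = 1) ∧ ∀ i r, x i r = 0 ∨ x i r = 1

/-- Global minimizer of the continuous relaxation. -/
def IsRelaxMin {n : ℕ} {l : Fin n → ℕ}
    (a : (i : Fin n) → Fin (l i) → ℝ)
    (B : (i : Fin n) → (j : Fin n) → Matrix (Fin (l i)) (Fin (l j)) ℝ)
    (x : (i : Fin n) → Fin (l i) → ℝ) : Prop :=
  RelaxFeas x ∧ ∀ y, RelaxFeas y → qsapF a B x ≤ qsapF a B y

/-- Global minimizer of the CPD integer problem. -/
def IsIntMin {n : ℕ} {l : Fin n → ℕ}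
    (a : (i : Fin n) → Fin (l i) → ℝ)
    (B : (i : Fin n) → (j : Fin n) → Matrix (Fin (l i)) (Fin (l j)) ℝ)
    (x : (i : Fin n) → Fin (l i) → ℝ) : Prop :=
  IntFeas x ∧ ∀ y, IntFeas y → qsapF a B x ≤ qsapF a B y

/-- `‖x‖₀`, the number of nonzero entries of `x`. -/
def norm0 {n : ℕ} {l : Fin n → ℕ} (x : (i : Fin n) → Fin (l i) → ℝ) : ℕ :=
  Set.ncard {p : Σ i : Fin n, Fin (l i) | x p.1 p.2 ≠ 0}

/-- The support `Γ(x) = {(i,r) : x^{(i)}_r > 0}`. -/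
def supp {n : ℕ} {l : Fin n → ℕ} (x : (i : Fin n) → Fin (l i) → ℝ) :
    Set (Σ i : Fin n, Fin (l i)) :=
  {p | 0 < x p.1 p.2}

/-- The per-block argmax set `J_i(x) = argmax_r x^{(i)}_r`. -/
def Jblock {n : ℕ} {l : Fin n → ℕ} (x : (i : Fin n) → Fin (l i) → ℝ) (i : Fin n) :
    Set (Fin (l i)) :=
  {r | ∀ r', x i r' ≤ x i r}

/-- The combined argmax set `J(x) = ∪_i {i} × J_i(x)`. -/
def Jset {n : ℕ} {l : Fin n → ℕ} (x : (i : Fin n) → Fin (l i) → ℝ) :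
    Set (Σ i : Fin n, Fin (l i)) :=
  {p | ∀ r', x p.1 r' ≤ x p.1 p.2}


def AffL {k : ℕ} (g : (Fin k → ℝ) → ℝ) : Prop :=
  ∀ v : Fin k → ℝ, ∑ r, v r = 1 → g v = ∑ r, v r * g (Pi.single r 1)

lemma AffL.const {k : ℕ} (c : ℝ) : AffL (fun _ : Fin k → ℝ => c) := by
  intro v hv
  simp only [← Finset.sum_mul, hv, one_mul]

lemma AffL.coord {k : ℕ} (q : Fin k) : AffL (fun v : Fin k → ℝ => v q) := by
  intro v hv
  simp [Pi.single_apply]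

lemma AffL.cmul {k : ℕ} {g : (Fin k → ℝ) → ℝ} (hg : AffL g) (c : ℝ) :
    AffL (fun v => c * g v) := by
  intro v hv
  simp only [hg v hv, Finset.mul_sum]
  exact Finset.sum_congr rfl fun r _ => by ring

lemma AffL.add {k : ℕ} {g h : (Fin k → ℝ) → ℝ} (hg : AffL g) (hh : AffL h) :
    AffL (fun v => g v + h v) := by
  intro v hv
  simp only [hg v hv, hh v hv, mul_add, Finset.sum_add_distrib]

lemma AffL.sum {k : ℕ} {ι : Type} (t : Finset ι) {g : ι → (Fin k → ℝ) → ℝ}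
    (hg : ∀ i, AffL (g i)) : AffL (fun v => ∑ i ∈ t, g i v) := by
  intro v hv
  simp only [Finset.mul_sum]
  rw [Finset.sum_comm]
  exact Finset.sum_congr rfl fun i _ => hg i v hv

lemma affL_upd {n : ℕ} {l : Fin n → ℕ} (x : (i : Fin n) → Fin (l i) → ℝ) (i j : Fin n)
    (r : Fin (l j)) : AffL (fun v => Function.update x i v j r) := by
  by_cases h : j = i
  · subst h
    simpa using AffL.coord r
  · simpa [Function.update_of_ne h] using AffL.const (x j r)

lemma affL_qsapF {n : ℕ} {l : Fin n → ℕ}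
    (a : (i : Fin n) → Fin (l i) → ℝ)
    (B : (i : Fin n) → (j : Fin n) → Matrix (Fin (l i)) (Fin (l j)) ℝ)
    (hdiag : ∀ i, B i i = 0)
    (x : (i : Fin n) → Fin (l i) → ℝ) (i : Fin n) :
    AffL (fun v => qsapF a B (Function.update x i v)) := by
  unfold qsapF
  refine AffL.add (AffL.cmul ?_ _) ?_
  · refine AffL.sum _ fun j => AffL.sum _ fun k => AffL.sum _ fun r => AffL.sum _ fun q => ?_
    by_cases hj : j = i
    · by_cases hk : k = i
      · subst hj
        subst hk
        simpa [hdiag] using AffL.const (k := l k) 0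
      · have := (affL_upd x i j r).cmul (B j k r q * x k q)
        simp only [Function.update_of_ne hk]
        convert this using 2
        ring
    · simp only [Function.update_of_ne hj]
      exact (affL_upd x i k q).cmul _
  · exact AffL.sum _ fun j => AffL.sum _ fun r => (affL_upd x i j r).cmul _

lemma relaxFeas_upd {n : ℕ} {l : Fin n → ℕ} {x : (i : Fin n) → Fin (l i) → ℝ}
    (hx : RelaxFeas x) (i : Fin n) (r : Fin (l i)) :
    RelaxFeas (Function.update x i (Pi.single r 1)) := by
  constructor
  · intro j
    by_cases h : j = i
    · subst h
      simp
    · simpa [Function.update_of_ne h] using hx.1 j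
  · intro j q
    by_cases h : j = i
    · subst h
      simp only [Function.update_self, Pi.single_apply]
      split_ifs <;> norm_num
    · simpa [Function.update_of_ne h] using hx.2 j q

lemma relaxMin_upd {n : ℕ} {l : Fin n → ℕ}
    (a : (i : Fin n) → Fin (l i) → ℝ)
    (B : (i : Fin n) → (j : Fin n) → Matrix (Fin (l i)) (Fin (l j)) ℝ)
    (hdiag : ∀ i, B i i = 0)
    {x : (i : Fin n) → Fin (l i) → ℝ} (hx : IsRelaxMin a B x) (i : Fin n) (r : Fin (l i))
    (hr : 0 < x i r) :
    IsRelaxMin a B (Function.update x i (Pi.single r 1)) := by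
  refine ⟨relaxFeas_upd hx.1 i r, fun y hy => le_trans ?_ (hx.2 y hy)⟩
  have h := affL_qsapF a B hdiag x i (x i) (hx.1.1 i)
  simp only [Function.update_eq_self] at h
  by_contra! hlt
  have h2 : ∑ q, x i q * qsapF a B x <
      ∑ q, x i q * qsapF a B (Function.update x i (Pi.single q 1)) := by
    refine Finset.sum_lt_sum (fun q _ => ?_) ⟨r, Finset.mem_univ _, ?_⟩
    · exact mul_le_mul_of_nonneg_left (hx.2 _ (relaxFeas_upd hx.1 i q)) (hx.1.2 i q)
    · exact mul_lt_mul_of_pos_left hlt hr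
  rw [← Finset.sum_mul, hx.1.1 i, one_mul] at h2
  linarith

/-- if `z` is a global minimizer of the relaxation and each block
argmax set `J_i(z)` is the singleton `{s i}`, then the 0/1 point `x*` with
`x*^{(i)} = e_{s i}` globally solves the integer problem, and
`Γ(x*) = {(i, s i) : i}`. -/
theorem stmt11 {n : ℕ} {l : Fin n → ℕ} (hn : 1 ≤ n) (hl : ∀ i, 1 ≤ l i)
    (a : (i : Fin n) → Fin (l i) → ℝ)
    (B : (i : Fin n) → (j : Fin n) → Matrix (Fin (l i)) (Fin (l j)) ℝ)
    (hsym : ∀ i j r s, B i j r s = B j i s r)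
    (hdiag : ∀ i, B i i = 0)
    (z : (i : Fin n) → Fin (l i) → ℝ)
    (hz : IsRelaxMin a B z)
    (s : (i : Fin n) → Fin (l i))
    (hJ : ∀ i, Jblock z i = {s i}) :
    let xstar : (i : Fin n) → Fin (l i) → ℝ := fun i r => if r = s i then 1 else 0
    IsIntMin a B xstar ∧
    supp xstar = Set.range (fun i => (⟨i, s i⟩ : Σ i : Fin n, Fin (l i))) := by
  intro xstar
  have hpos : ∀ i, 0 < z i (s i) := by
    intro i
    by_contra! h
    have hm : s i ∈ Jblock z i := by rw [hJ i]; rfl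
    have h1 : ∑ r, z i r ≤ 0 := Finset.sum_nonpos fun r _ => (hm r).trans h
    have := hz.1.1 i
    linarith
  have key : ∀ S : Finset (Fin n),
      IsRelaxMin a B (fun i => if i ∈ S then Pi.single (s i) 1 else z i) := by
    intro S
    induction S using Finset.induction_on with
    | empty => simpa using hz
    | insert i S hi ih =>
      have h := relaxMin_upd a B hdiag ih i (s i) (by simpa [hi] using hpos i)
      convert h using 1
      funext j
      by_cases hj : j = i
      · subst hj
        simp
      · simp [Function.update_of_ne hj, hj]
  have hx : IsRelaxMin a B xstar := by
    convert key Finset.univ using 1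
    funext i r
    simp [xstar, Pi.single_apply]
  refine ⟨⟨⟨hx.1.1, ?_⟩, ?_⟩, ?_⟩
  · intro i r
    by_cases h : r = s i <;> simp [xstar, h]
  · intro y hy
    refine hx.2 y ⟨hy.1, fun i r => ?_⟩
    rcases hy.2 i r with h | h <;> simp [h]
  · ext ⟨i, r⟩
    simp only [supp, Set.mem_setOf_eq, Set.mem_range, xstar]
    constructor
    · intro h
      by_cases hr : r = s i
      · exact ⟨i, by rw [hr]⟩
      · simp [hr] at h
    · rintro ⟨j, hj⟩
      cases hj
      simp

end
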